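/- arXiv:2207.02609 — 2 statements merged into one kernel-verified Lean document; each statement's English description precedes it below -/
import Mathlib

section
/- Let (X = C ⊔ F, d) be a finite metric space with clients C and facilities F, let κ : F → ℝ≥0, let O ⊆ F, r ≥ 0 and γ ∈ ℕ. Then there exist S ⊆ O with |S| ≤ γ and σ ≥ 0 such that, with D = B_F(S, 4r): (i) κ(S) + γ·σ ≤ κ(O ∩ D); (ii) every f ∈ O ∖ D with κ(f) > σ satisfies d(f, g) > 4r for every g ∈ O ∖ D with g ≠ f; and (iii) B_C(O ∩ D, r) ⊆ B_C(S, 5r). -/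
open Finset

attribute [local instance] Classical.propDecidable

/-- `B_U(V,s)`: the elements of `U` within distance `s` of some point of `V`. -/
noncomputable def ballIn {X : Type*} [MetricSpace X] [Fintype X]
    (U V : Finset X) (s : ℝ) : Finset X :=
  U.filter fun u => ∃ v ∈ V, dist v u ≤ s

theorem mem_ballIn {X : Type*} [MetricSpace X] [Fintype X] {U V : Finset X} {s : ℝ} {u : X} :
    u ∈ ballIn U V s ↔ u ∈ U ∧ ∃ v ∈ V, dist v u ≤ s := by
  simp [ballIn]

theorem ballIn_mono {X : Type*} [MetricSpace X] [Fintype X] {U V W : Finset X} (h : V ⊆ W)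
    (s : ℝ) : ballIn U V s ⊆ ballIn U W s := by
  intro u hu
  obtain ⟨huU, v, hv, hvu⟩ := mem_ballIn.1 hu
  exact mem_ballIn.2 ⟨huU, v, h hv, hvu⟩

theorem ballIn_inter_ballIn_subset {X : Type*} [MetricSpace X] [Fintype X]
    (C F O S : Finset X) (s t : ℝ) :
    ballIn C (O ∩ ballIn F S s) t ⊆ ballIn C S (s + t) := by
  intro c hc
  obtain ⟨hcC, v, hv, hvc⟩ := mem_ballIn.1 hc
  obtain ⟨-, w, hw, hwv⟩ := mem_ballIn.1 (mem_inter.1 hv).2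
  exact mem_ballIn.2 ⟨hcC, w, hw, (dist_triangle w v c).trans (add_le_add hwv hvc)⟩

/-- Greedy choice of centers: as long as some facility outside the balls is not well-separated,
add a close neighbour of a most expensive such facility, whose cost is the new threshold. -/
theorem exists_centers_and_threshold {X : Type*} [MetricSpace X] [Fintype X]
    (F : Finset X) (κ : X → ℝ) (hκ : ∀ f, 0 ≤ κ f) (O : Finset X) (hO : O ⊆ F)
    (t : ℝ) (ht : 0 ≤ t) (γ : ℕ) :
    ∃ S ⊆ O, ∃ σ : ℝ, 0 ≤ σ ∧ S.card ≤ γ ∧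
      ((∑ f ∈ S, κ f) + γ * σ ≤ ∑ f ∈ O ∩ ballIn F S t, κ f) ∧
      (∀ f ∈ O \ ballIn F S t, σ < κ f →
        ∀ g ∈ O \ ballIn F S t, g ≠ f → t < dist f g) := by
  induction γ with
  | zero =>
    refine ⟨∅, empty_subset _, ∑ x, κ x, sum_nonneg fun x _ => hκ x, by simp, ?_, ?_⟩
    · simpa using sum_nonneg fun x _ => hκ x
    · intro f _ hf
      exact absurd (single_le_sum (fun x _ => hκ x) (mem_univ f)) hf.not_ge
  | succ n ih =>
    obtain ⟨S, hSO, σ, hσ, hcard, hsum, hsep⟩ := ih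
    set D := ballIn F S t
    set A := (O \ D).filter fun f => ∃ g ∈ O \ D, g ≠ f ∧ dist f g ≤ t
    rcases A.eq_empty_or_nonempty with hempty | hne
    · refine ⟨S, hSO, 0, le_rfl, hcard.trans n.le_succ, ?_, ?_⟩
      · have : 0 ≤ (n : ℝ) * σ := by positivity
        linarith
      · intro f hf _ g hg hgf
        by_contra! hle
        have : f ∈ A := mem_filter.2 ⟨hf, g, hg, hgf, hle⟩
        simp [hempty] at this
    · obtain ⟨f, hfA, hmax⟩ := exists_max_image A κ hne
      obtain ⟨hf, g, hg, hgf, hfg⟩ := mem_filter.1 hfA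
      have hfσ : κ f ≤ σ := by
        by_contra! h
        exact (hsep f hf h g hg hgf).not_ge hfg
      obtain ⟨hfO, hfD⟩ := mem_sdiff.1 hf
      obtain ⟨hgO, hgD⟩ := mem_sdiff.1 hg
      have hgS : g ∉ S := fun h => hgD (mem_ballIn.2 ⟨hO hgO, g, h, by simpa using ht⟩)
      have hDD : D ⊆ ballIn F (insert g S) t := ballIn_mono (subset_insert g S) t
      have hOD : O \ ballIn F (insert g S) t ⊆ O \ D := sdiff_subset_sdiff le_rfl hDD
      refine ⟨insert g S, insert_subset hgO hSO, κ f, hκ f, ?_, ?_, ?_⟩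
      · rw [card_insert_of_notMem hgS]
        omega
      · have hsub : insert f (insert g (O ∩ D)) ⊆ O ∩ ballIn F (insert g S) t := by
          refine insert_subset (mem_inter.2 ⟨hfO, mem_ballIn.2 ⟨hO hfO, g, mem_insert_self g S, ?_⟩⟩)
            (insert_subset (mem_inter.2 ⟨hgO, mem_ballIn.2 ⟨hO hgO, g, mem_insert_self g S, ?_⟩⟩)
              (inter_subset_inter le_rfl hDD))
          · rwa [dist_comm]
          · simpa using ht
        have hle := sum_le_sum_of_subset_of_nonneg hsub fun x _ _ => hκ x
        rw [sum_insert (by simp [hfD, hgf.symm]), sum_insert (by simp [hgD])] at hle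
        have hmul : (n : ℝ) * κ f ≤ n * σ := by gcongr
        rw [sum_insert hgS]
        push_cast
        linarith
      · intro f' hf' hlt g' hg' hne'
        by_contra! hle
        exact (hmax f' (mem_filter.2 ⟨hOD hf', g', hOD hg', hne', hle⟩)).not_gt hlt

/-- Phase 0 (Cost-Guessing): there are `S ⊆ O` with `|S| ≤ γ` and a
savings threshold `σ ≥ 0` such that, with `D = B_F(S,4r)`: the cost of `S` plus `γ·σ` is
at most the cost of `O ∩ D`; every remaining facility of `O ∖ D` of cost exceeding `σ` is
well-separated from all other facilities of `O ∖ D`; and `B_C(O ∩ D, r) ⊆ B_C(S, 5r)`. -/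
theorem cost_guessing_phase {X : Type*} [MetricSpace X] [Fintype X]
    (C F : Finset X) (hdisj : Disjoint C F) (hcover : C ∪ F = Finset.univ)
    (κ : X → ℝ) (hκ : ∀ f, 0 ≤ κ f)
    (O : Finset X) (hO : O ⊆ F) (r : ℝ) (hr : 0 ≤ r) (γ : ℕ) :
    ∃ S ⊆ O, ∃ σ : ℝ, 0 ≤ σ ∧ S.card ≤ γ ∧
      ((∑ f ∈ S, κ f) + γ * σ ≤ ∑ f ∈ O ∩ ballIn F S (4 * r), κ f) ∧
      (∀ f ∈ O \ ballIn F S (4 * r), σ < κ f →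
        ∀ g ∈ O \ ballIn F S (4 * r), g ≠ f → 4 * r < dist f g) ∧
      ballIn C (O ∩ ballIn F S (4 * r)) r ⊆ ballIn C S (5 * r) := by
  obtain ⟨S, hSO, σ, hσ, hcard, hsum, hsep⟩ :=
    exists_centers_and_threshold F κ hκ O hO (4 * r) (by positivity) γ
  refine ⟨S, hSO, σ, hσ, hcard, hsum, hsep, ?_⟩
  rw [show 5 * r = 4 * r + r by ring]
  exact ballIn_inter_ballIn_subset C F O S (4 * r) r
end

section
/- Let (X = C ⊔ F, d) be a finite metric space with clients C and facilities F, r ≥ 0, γ ≥ 1, κ : F → ℝ≥0, K, σ ≥ 0, color functions w_ℓ : C → ℝ≥0, requirements m_ℓ ≥ 0 and thresholds τ_ℓ ≥ 0 for ℓ ∈ [γ]. Let Q ⊆ C be finite and let {D_c}_{c∈Q} be pairwise disjoint subsets of C with D_c ⊆ B_C(c, 2r) for each c. Define η(c) = min_{f∈B_F(c,r)} κ(f). Let z : Q → [0,1] have at most γ coordinates strictly between 0 and 1, with ∑_{c∈Q} η(c) z(c) ≤ K and ∑_{c∈Q} w_ℓ(D_c) z(c) ≥ m_ℓ for all ℓ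 ∈ [γ]; assume B_F(c,r) ≠ ∅ for every c with z(c) = 1, and that every c with 0 < z(c) < 1 satisfies either (i) w_ℓ(D_c) ≤ 3τ_ℓ for all ℓ ∈ [γ], or (ii) there exists f ∈ B_F(c, 5r) with κ(f) ≤ σ. Then there exists S ⊆ F with ∑_{f∈S} κ(f) ≤ K + γσ and w_ℓ(B_C(S, 7r)) ≥ m_ℓ − 3γτ_ℓ for all ℓ ∈ [γ]. -/
open Finset

attribute [local instance] Classical.propDecidable

/-- `η(c) = min_{f ∈ B_F(c,r)} κ(f)`. -/
noncomputable def cheapestNearby {X : Type*} [MetricSpace X] [Fintype X]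
    (F : Finset X) (κ : X → ℝ) (r : ℝ) (c : X) : ℝ :=
  sInf ((((ballIn F {c} r).image κ) : Finset ℝ) : Set ℝ)

/-- The minimum `η(c)` is nonnegative, also when no facility is nearby. -/
lemma cheapestNearby_nonneg {X : Type*} [MetricSpace X] [Fintype X]
    (F : Finset X) {κ : X → ℝ} (hκ : ∀ f, 0 ≤ κ f) (r : ℝ) (c : X) :
    0 ≤ cheapestNearby F κ r c := by
  refine Real.sInf_nonneg fun x hx => ?_
  obtain ⟨f, -, rfl⟩ := Finset.mem_image.1 (Finset.mem_coe.1 hx)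
  exact hκ f

/-- The minimum `η(c)` is attained as soon as some facility is nearby. -/
lemma exists_eq_cheapestNearby {X : Type*} [MetricSpace X] [Fintype X]
    {F : Finset X} (κ : X → ℝ) {r : ℝ} {c : X} (h : (ballIn F {c} r).Nonempty) :
    ∃ f ∈ F, dist c f ≤ r ∧ κ f = cheapestNearby F κ r c := by
  have hmem := (h.image κ).csInf_mem
  obtain ⟨f, hf, hfκ⟩ := Finset.mem_image.1 hmem
  simp only [ballIn, Finset.mem_filter, Finset.mem_singleton, exists_eq_left] at hf
  exact ⟨f, hf.1, hf.2, hfκ⟩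

/-- If every `c ∈ A` is within `s` of its facility `g c` and `D c` lies within `t` of `c`, then the
facilities `g c` cover all the disjoint sets `D c` within radius `s + t`. -/
lemma sum_le_sum_ballIn_image {X : Type*} [MetricSpace X] [Fintype X]
    {C A : Finset X} {D : X → Finset X} {g : X → X} {s t : ℝ} {w : X → ℝ} (hw : ∀ x, 0 ≤ w x)
    (hD : ∀ c ∈ A, D c ⊆ ballIn C {c} t)
    (hdisj : ∀ c ∈ A, ∀ c' ∈ A, c ≠ c' → Disjoint (D c) (D c'))
    (hg : ∀ c ∈ A, dist c (g c) ≤ s) :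
    ∑ c ∈ A, ∑ b ∈ D c, w b ≤ ∑ b ∈ ballIn C (A.image g) (s + t), w b := by
  rw [← Finset.sum_biUnion fun c hc c' hc' => hdisj c hc c' hc']
  refine Finset.sum_le_sum_of_subset_of_nonneg (fun b hb => ?_) fun b _ _ => hw b
  obtain ⟨c, hc, hbc⟩ := Finset.mem_biUnion.1 hb
  have hb' := hD c hc hbc
  simp only [ballIn, Finset.mem_filter, Finset.mem_singleton, exists_eq_left] at hb' ⊢
  refine ⟨hb'.1, g c, Finset.mem_image_of_mem g hc, ?_⟩
  have htri := dist_triangle_left (g c) b c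
  linarith [hg c hc, hb'.2]

/-- A quantity that exceeds `a` by at most `x` on the exceptional indices, of which there are at
most `n`, and nowhere else, has sum at most `∑ a + n * x`. -/
lemma sum_le_sum_add_card_mul {ι : Type*} {Q : Finset ι} {p : ι → Prop} [DecidablePred p] {n : ℕ} {x : ℝ}
    {u a : ι → ℝ} (hx : 0 ≤ x) (hcard : (Q.filter p).card ≤ n)
    (h : ∀ c ∈ Q, u c ≤ a c + if p c then x else 0) :
    ∑ c ∈ Q, u c ≤ ∑ c ∈ Q, a c + n * x := by
  refine (Finset.sum_le_sum h).trans ?_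
  rw [Finset.sum_add_distrib, ← Finset.sum_filter, Finset.sum_const, nsmul_eq_mul]
  gcongr

/-- Rounding step on the sparse part: from a feasible point `z` of the
Flower-polytope with at most `γ` fractional coordinates, where each fractional coordinate
is either light (weight at most `3τ_ℓ` in each color) or can be served by a facility of
cost at most `σ` within distance `5r`, one obtains a set `S ⊆ F` of facilities of cost at
most `K + γσ` covering, within radius `7r`, at least `m_ℓ - 3γτ_ℓ` in each color. -/
theorem sparse_rounding {X : Type*} [MetricSpace X] [Fintype X]
    (C F : Finset X) (hdisj : Disjoint C F) (hcover : C ∪ F = Finset.univ)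
    (r : ℝ) (hr : 0 ≤ r) (γ : ℕ) (hγ : 1 ≤ γ)
    (κ : X → ℝ) (hκ : ∀ f, 0 ≤ κ f)
    (K σ : ℝ) (hK : 0 ≤ K) (hσ : 0 ≤ σ)
    (w : Fin γ → X → ℝ) (hw : ∀ ℓ x, 0 ≤ w ℓ x)
    (m τ : Fin γ → ℝ) (hm : ∀ ℓ, 0 ≤ m ℓ) (hτ : ∀ ℓ, 0 ≤ τ ℓ)
    (Q : Finset X) (hQC : Q ⊆ C)
    (D : X → Finset X) (hD : ∀ c ∈ Q, D c ⊆ ballIn C {c} (2 * r))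
    (hDdisj : ∀ c ∈ Q, ∀ c' ∈ Q, c ≠ c' → Disjoint (D c) (D c'))
    (z : X → ℝ) (hz : ∀ c ∈ Q, 0 ≤ z c ∧ z c ≤ 1)
    (hfrac : (Q.filter fun c => 0 < z c ∧ z c < 1).card ≤ γ)
    (hbudget : ∑ c ∈ Q, cheapestNearby F κ r c * z c ≤ K)
    (hcov : ∀ ℓ, m ℓ ≤ ∑ c ∈ Q, (∑ b ∈ D c, w ℓ b) * z c)
    (hone : ∀ c ∈ Q, z c = 1 → (ballIn F {c} r).Nonempty)
    (hfcase : ∀ c ∈ Q, 0 < z c → z c < 1 →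
      (∀ ℓ, ∑ b ∈ D c, w ℓ b ≤ 3 * τ ℓ) ∨
      ∃ f ∈ F, dist c f ≤ 5 * r ∧ κ f ≤ σ) :
    ∃ S : Finset X, S ⊆ F ∧
      (∑ f ∈ S, κ f) ≤ K + γ * σ ∧
      ∀ ℓ, m ℓ - 3 * γ * τ ℓ ≤ ∑ c ∈ ballIn C S (7 * r), w ℓ c := by
  set A : Finset X := Q.filter fun c =>
    z c = 1 ∨ (0 < z c ∧ z c < 1 ∧ ∃ f ∈ F, dist c f ≤ 5 * r ∧ κ f ≤ σ) with hA
  have hη := cheapestNearby_nonneg F hκ r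
  have hex : ∀ c ∈ A, ∃ f ∈ F, dist c f ≤ 5 * r ∧
      κ f ≤ cheapestNearby F κ r c * z c + if 0 < z c ∧ z c < 1 then σ else 0 := by
    intro c hc
    obtain ⟨hcQ, h1 | ⟨h0, h1, f, hfF, hcf, hfσ⟩⟩ := Finset.mem_filter.1 hc
    · obtain ⟨f, hfF, hcf, hfκ⟩ := exists_eq_cheapestNearby κ (hone c hcQ h1)
      exact ⟨f, hfF, by linarith, by simp [h1, hfκ]⟩
    · refine ⟨f, hfF, hcf, ?_⟩
      rw [if_pos ⟨h0, h1⟩]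
      linarith [mul_nonneg (hη c) h0.le]
  choose! g hgF hgd hgκ using hex
  refine ⟨A.image g, Finset.image_subset_iff.2 hgF, ?_, fun ℓ => ?_⟩
  · calc ∑ f ∈ A.image g, κ f ≤ ∑ c ∈ A, κ (g c) :=
          Finset.sum_image_le_of_nonneg fun f _ => hκ f
      _ = ∑ c ∈ Q, if c ∈ A then κ (g c) else 0 := by
          rw [← Finset.sum_filter, Finset.filter_mem_eq_inter,
            Finset.inter_eq_right.2 (Finset.filter_subset _ _)]
      _ ≤ ∑ c ∈ Q, cheapestNearby F κ r c * z c + γ * σ := by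
          refine sum_le_sum_add_card_mul hσ hfrac fun c hc => ?_
          by_cases hcA : c ∈ A
          · simpa only [if_pos hcA] using hgκ c hcA
          · rw [if_neg hcA]
            have := mul_nonneg (hη c) (hz c hc).1
            split_ifs <;> linarith
      _ ≤ K + γ * σ := by gcongr
  · have hW : ∀ c, 0 ≤ ∑ b ∈ D c, w ℓ b := fun c => Finset.sum_nonneg fun b _ => hw ℓ b
    have hround : ∑ c ∈ Q, (∑ b ∈ D c, w ℓ b) * z c ≤
        (∑ c ∈ Q, if c ∈ A then ∑ b ∈ D c, w ℓ b else 0) + γ * (3 * τ ℓ) := by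
      refine sum_le_sum_add_card_mul (mul_nonneg zero_le_three (hτ ℓ)) hfrac fun c hc => ?_
      have hle := mul_le_of_le_one_right (hW c) (hz c hc).2
      by_cases hcA : c ∈ A
      · rw [if_pos hcA]
        have := hτ ℓ
        split_ifs <;> linarith
      · rw [if_neg hcA]
        simp only [hA, Finset.mem_filter, hc, true_and, not_or] at hcA
        rcases (hz c hc).1.eq_or_lt with h0 | h0
        · simp [← h0]
        · have h1 := lt_of_le_of_ne (hz c hc).2 hcA.1
          rw [if_pos ⟨h0, h1⟩]
          rcases hfcase c hc h0 h1 with hlight | hserved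
          · linarith [hlight ℓ]
          · exact absurd ⟨h0, h1, hserved⟩ hcA.2
    rw [← Finset.sum_filter, Finset.filter_mem_eq_inter,
      Finset.inter_eq_right.2 (Finset.filter_subset _ _)] at hround
    have hAQ : ∀ c ∈ A, c ∈ Q := fun c hc => (Finset.mem_filter.1 hc).1
    have hcovered := sum_le_sum_ballIn_image (hw ℓ) (fun c hc => hD c (hAQ c hc))
      (fun c hc c' hc' => hDdisj c (hAQ c hc) c' (hAQ c' hc')) hgd
    rw [show 5 * r + 2 * r = 7 * r by ring] at hcovered
    linarith [hcov ℓ]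
end
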